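/- Let n ≥ 2, 1 ≤ k ≤ n−1 be integers and p = 0. Let f be a smooth, even, positive function on 𝕊ⁿ and let φ > 1 be a smooth, even, h-convex solution of σ_k(A[φ]) = φ^{−k} f on 𝕊ⁿ. Then min_{𝕊ⁿ} φ ≥ C₀ := (1/2)(1 + 2 min(f/C(n,k))^{1/k})^{1/2} + (1/2)(1 + 2 min(f/C(n,k))^{1/k})^{−1/2} > 1, and max_{𝕊ⁿ} φ ≤ (1 + 2 max_{𝕊ⁿ}(f/C(n,k))^{1/k})^{1/2} + (2 max_{𝕊ⁿ}(f/C(n,k))^{1/k})^{1/2}. -/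

import Mathlib

open scoped RealInnerProductSpace
open Finset

noncomputable section

/-- Euclidean space `ℝ^(n+1)`, the ambient space of the unit sphere `𝕊ⁿ`. -/
abbrev Euc (n : ℕ) : Type := EuclideanSpace ℝ (Fin (n + 1))

/-- The unit sphere `𝕊ⁿ ⊆ ℝ^(n+1)`. -/
def uSphere (n : ℕ) : Set (Euc n) := Metric.sphere (0 : Euc n) 1

/-- Orthogonal projection onto the tangent space of the sphere at (the normalization of) `x`. -/
def tanProj {n : ℕ} (x v : Euc n) : Euc n := v - (⟪x, v⟫ / ‖x‖ ^ 2) • x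

/-- `f` is (the 0-homogeneous extension of) a function on the sphere. -/
def Homog0 {n : ℕ} (f : Euc n → ℝ) : Prop := ∀ (c : ℝ) (y : Euc n), 0 < c → f (c • y) = f y

/-- Smoothness of a function on the sphere, expressed via its 0-homogeneous extension. -/
def SmoothFn {n : ℕ} (f : Euc n → ℝ) : Prop := ContDiffOn ℝ (⊤ : ℕ∞) f {y : Euc n | y ≠ 0}

/-- `f(x) = f(-x)` for all `x`. -/
def EvenFn {n : ℕ} (f : Euc n → ℝ) : Prop := ∀ y, f (-y) = f y

/-- Covariant (tangential) derivative of a function on the sphere, in direction `v`. -/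
def covD {n : ℕ} (f : Euc n → ℝ) (x v : Euc n) : ℝ := fderiv ℝ f x (tanProj x v)

/-- Spherical (tangential) gradient. -/
def gradS {n : ℕ} (f : Euc n → ℝ) (x : Euc n) : Euc n := tanProj x (gradient f x)

/-- Covariant Hessian `(D²f)(v,w)` of a function on the round sphere. -/
def hessS {n : ℕ} (f : Euc n → ℝ) (x v w : Euc n) : ℝ :=
  fderiv ℝ (fun y => covD f y w) x (tanProj x v)

/-- The symmetric 2-tensor
`A[φ](v,w) = (D²φ)(v,w) - (|Dφ|²/(2φ)) σ(v,w) + ((φ - 1/φ)/2) σ(v,w)` on the sphere. -/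
def Aform {n : ℕ} (φ : Euc n → ℝ) (x v w : Euc n) : ℝ :=
  hessS φ x v w +
    ((φ x - (φ x)⁻¹) / 2 - ‖gradS φ x‖ ^ 2 / (2 * φ x)) * ⟪tanProj x v, tanProj x w⟫

/-- `φ` is h-convex: `A[φ] ≥ 0` on the sphere. -/
def HConvex {n : ℕ} (φ : Euc n → ℝ) : Prop :=
  ∀ x ∈ uSphere n, ∀ v : Euc n, ⟪x, v⟫ = 0 → 0 ≤ Aform φ x v v

/-- `φ` is uniformly h-convex: `A[φ] > 0` on the sphere. -/
def UnifHConvex {n : ℕ} (φ : Euc n → ℝ) : Prop :=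
  ∀ x ∈ uSphere n, ∀ v : Euc n, ⟪x, v⟫ = 0 → v ≠ 0 → 0 < Aform φ x v v

/-- `σ_k` of a square matrix: the sum of its principal `k × k` minors
(equivalently, the `k`-th elementary symmetric function of its eigenvalues). -/
def sigmaMat {N : ℕ} (k : ℕ) (M : Matrix (Fin N) (Fin N) ℝ) : ℝ :=
  ∑ s ∈ Finset.powersetCard k (Finset.univ : Finset (Fin N)),
    Matrix.det (Matrix.of fun i j : {a : Fin N // a ∈ s} => M i.1 j.1)

/-- `e` is an orthonormal frame of the tangent space of `𝕊ⁿ` at `x`. -/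
def OrthoFrame {n : ℕ} (x : Euc n) (e : Fin n → Euc n) : Prop :=
  (∀ i, ⟪x, e i⟫ = 0) ∧ ∀ i j, ⟪e i, e j⟫ = if i = j then 1 else 0

/-- The matrix of `A[φ]` at `x` with respect to an orthonormal tangent frame `e`. -/
def Amat {n : ℕ} (φ : Euc n → ℝ) (x : Euc n) (e : Fin n → Euc n) : Matrix (Fin n) (Fin n) ℝ :=
  Matrix.of fun i j => Aform φ x (e i) (e j)

/-- `φ` solves the horospherical `p`-Christoffel-Minkowski equation
`σ_k(A[φ]) = φ^(p-k) f` on `𝕊ⁿ`. -/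
def SolvesCM (n k : ℕ) (p : ℝ) (f φ : Euc n → ℝ) : Prop :=
  ∀ x ∈ uSphere n, ∀ e : Fin n → Euc n, OrthoFrame x e →
    sigmaMat k (Amat φ x e) = φ x ^ (p - (k : ℝ)) * f x

/-- Supremum (maximum) of a function over the sphere. -/
def sphSup {n : ℕ} (f : Euc n → ℝ) : ℝ := sSup (f '' uSphere n)

/-- Infimum (minimum) of a function over the sphere. -/
def sphInf {n : ℕ} (f : Euc n → ℝ) : ℝ := sInf (f '' uSphere n)

/-- The function `f^(-1/q)`. -/
def negPowExt {n : ℕ} (f : Euc n → ℝ) (q : ℝ) : Euc n → ℝ := fun y => f y ^ (-(1 / q))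

/-- Assumption 1.3 of the paper (Assumption (A)): the gradient-and-Hessian conditions on the
prescribed function `f`, according to the value of `p`. -/
def AssumptionA (n k : ℕ) (p : ℝ) (f : Euc n → ℝ) : Prop :=
  ((p = 0) →
    ∀ x ∈ uSphere n, ∀ v : Euc n, ⟪x, v⟫ = 0 →
      0 ≤ hessS (negPowExt f (k : ℝ)) x v v - ‖gradS (negPowExt f (k : ℝ)) x‖ * ‖v‖ ^ 2 +
          negPowExt f (k : ℝ) x /
              (2 + 8 * sphSup fun y => (f y / (n.choose k : ℝ)) ^ (1 / (k : ℝ))) * ‖v‖ ^ 2) ∧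
  ((0 < p ∧ p ≤ (k : ℝ) / 2) →
    ∀ x ∈ uSphere n, ∀ v : Euc n, ⟪x, v⟫ = 0 →
      0 ≤ hessS (negPowExt f (k : ℝ)) x v v -
            (((k : ℝ) + 2 * p) / (k : ℝ)) * ‖gradS (negPowExt f (k : ℝ)) x‖ * ‖v‖ ^ 2 +
          (p ^ 2 / (k : ℝ) ^ 2) * negPowExt f (k : ℝ) x * ‖v‖ ^ 2) ∧
  (((k : ℝ) / 2 < p ∧ p < (k : ℝ)) →
    ∀ x ∈ uSphere n, ∀ v : Euc n, ⟪x, v⟫ = 0 →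
      0 ≤ hessS (negPowExt f (k : ℝ)) x v v -
            ((3 * (k : ℝ) - 2 * p) ^ 2 / (p * (2 * p - (k : ℝ)))) *
              (‖gradS (negPowExt f (k : ℝ)) x‖ ^ 2 / (2 * negPowExt f (k : ℝ) x)) * ‖v‖ ^ 2 +
          (p / (2 * (k : ℝ))) * negPowExt f (k : ℝ) x * ‖v‖ ^ 2) ∧
  (((k : ℝ) ≤ p ∧ p < 2 * (k : ℝ)) →
    ∀ x ∈ uSphere n, ∀ v : Euc n, ⟪x, v⟫ = 0 →
      0 ≤ hessS (negPowExt f p) x v v -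
            (‖gradS (negPowExt f p) x‖ ^ 2 / (2 * negPowExt f p x)) * ‖v‖ ^ 2 +
          (1 / 2) * negPowExt f p x * ‖v‖ ^ 2) ∧
  ((p = 2 * (k : ℝ)) →
    sphSup f < (n.choose k : ℝ) / 2 ^ k ∧
    ∀ x ∈ uSphere n, ∀ v : Euc n, ⟪x, v⟫ = 0 →
      0 ≤ hessS (negPowExt f p) x v v -
            (‖gradS (negPowExt f p) x‖ ^ 2 / (2 * negPowExt f p x)) * ‖v‖ ^ 2 +
          (1 / 2) * negPowExt f p x * ‖v‖ ^ 2) ∧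
  ((2 * (k : ℝ) < p) →
    2 ≤ k ∧
    sphInf f ≤
      (k : ℝ) ^ k * (p - 2 * (k : ℝ)) ^ ((p - 2 * (k : ℝ)) / 2) / p ^ (p / 2) * (n.choose k : ℝ) ∧
    ∀ x ∈ uSphere n, ∀ v : Euc n, ⟪x, v⟫ = 0 →
      0 ≤ hessS (negPowExt f p) x v v -
            (‖gradS (negPowExt f p) x‖ ^ 2 / (2 * negPowExt f p x)) * ‖v‖ ^ 2 +
          ((k : ℝ) / p) * negPowExt f p x * ‖v‖ ^ 2)


namespace Matrix

variable {ι : Type*} [Fintype ι] [DecidableEq ι]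

theorem pow_card_le_det_of_posSemidef_sub {B : Matrix ι ι ℝ} {a : ℝ} (ha : 0 ≤ a)
    (h : (B - a • (1 : Matrix ι ι ℝ)).PosSemidef) : a ^ Fintype.card ι ≤ B.det := by
  have hB : B.IsHermitian := by
    have := h.1.add (isHermitian_one.smul (k := a) (IsSelfAdjoint.all a) :
      (a • (1 : Matrix ι ι ℝ)).IsHermitian)
    simpa using this
  rw [hB.det_eq_prod_eigenvalues, ← Finset.card_univ, ← Finset.prod_const]
  refine Finset.prod_le_prod (fun _ _ => ha) fun i _ => ?_
  have h1 := h.re_dotProduct_nonneg (hB.eigenvectorBasis i).ofLp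
  have h2 : star (hB.eigenvectorBasis i).ofLp ⬝ᵥ (hB.eigenvectorBasis i).ofLp = 1 := by
    have := hB.eigenvectorBasis.inner_eq_one i
    rwa [EuclideanSpace.inner_eq_star_dotProduct, dotProduct_comm] at this
  simp only [sub_mulVec, hB.mulVec_eigenvectorBasis, smul_mulVec, one_mulVec, dotProduct_sub,
    dotProduct_smul, h2] at h1
  simpa using h1

theorem det_le_pow_card_of_posSemidef {B : Matrix ι ι ℝ} {a : ℝ} (hB : B.PosSemidef)
    (h : (a • (1 : Matrix ι ι ℝ) - B).PosSemidef) : B.det ≤ a ^ Fintype.card ι := by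
  rw [hB.1.det_eq_prod_eigenvalues, ← Finset.card_univ, ← Finset.prod_const]
  refine Finset.prod_le_prod (fun i _ => hB.eigenvalues_nonneg i) fun i _ => ?_
  have h1 := h.re_dotProduct_nonneg (hB.1.eigenvectorBasis i).ofLp
  have h2 : star (hB.1.eigenvectorBasis i).ofLp ⬝ᵥ (hB.1.eigenvectorBasis i).ofLp = 1 := by
    have := hB.1.eigenvectorBasis.inner_eq_one i
    rwa [EuclideanSpace.inner_eq_star_dotProduct, dotProduct_comm] at this
  simp only [sub_mulVec, hB.1.mulVec_eigenvectorBasis, smul_mulVec, one_mulVec, dotProduct_sub,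
    dotProduct_smul, h2] at h1
  simpa using h1

end Matrix

theorem le_sigmaMat {N k : ℕ} {M : Matrix (Fin N) (Fin N) ℝ} {a : ℝ} (ha : 0 ≤ a)
    (h : (M - a • (1 : Matrix (Fin N) (Fin N) ℝ)).PosSemidef) :
    (N.choose k : ℝ) * a ^ k ≤ sigmaMat k M := by
  have : (N.choose k : ℝ) * a ^ k =
      ∑ s ∈ Finset.powersetCard k (Finset.univ : Finset (Fin N)), a ^ k := by simp
  rw [this, sigmaMat]
  refine Finset.sum_le_sum fun s hs => ?_
  have hc : Fintype.card {b : Fin N // b ∈ s} = k := by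
    rw [Fintype.card_coe, (Finset.mem_powersetCard.1 hs).2]
  rw [← hc]
  refine Matrix.pow_card_le_det_of_posSemidef_sub ha ?_
  have := h.submatrix (Subtype.val : {b : Fin N // b ∈ s} → Fin N)
  convert this using 1
  ext i j
  simp [Matrix.one_apply]

theorem sigmaMat_le {N k : ℕ} {M : Matrix (Fin N) (Fin N) ℝ} {a : ℝ} (hM : M.PosSemidef)
    (h : (a • (1 : Matrix (Fin N) (Fin N) ℝ) - M).PosSemidef) :
    sigmaMat k M ≤ (N.choose k : ℝ) * a ^ k := by
  have : (N.choose k : ℝ) * a ^ k =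
      ∑ s ∈ Finset.powersetCard k (Finset.univ : Finset (Fin N)), a ^ k := by simp
  rw [this, sigmaMat]
  refine Finset.sum_le_sum fun s hs => ?_
  have hc : Fintype.card {b : Fin N // b ∈ s} = k := by
    rw [Fintype.card_coe, (Finset.mem_powersetCard.1 hs).2]
  rw [← hc]
  refine Matrix.det_le_pow_card_of_posSemidef
    (hM.submatrix (Subtype.val : {b : Fin N // b ∈ s} → Fin N)) ?_
  have := h.submatrix (Subtype.val : {b : Fin N // b ∈ s} → Fin N)
  convert this using 1
  ext i j
  simp [Matrix.one_apply]

/-- Comparison of a solution of the differential inequality satisfied by h-convex functions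
along geodesics with the trigonometric solution of the corresponding
differential equation having the same initial value and vanishing initial slope. -/
theorem horospherical_comparison {g g₁ g₂ : ℝ → ℝ} (hg : ∀ t, HasDerivAt g (g₁ t) t)
    (hg₁ : ∀ t, HasDerivAt g₁ (g₂ t) t) (hpos : ∀ t, 0 < g t)
    (hineq : ∀ t, g₁ t ^ 2 / 2 - g t ^ 2 / 2 + 1 / 2 ≤ g t * g₂ t) (h0 : g₁ 0 = 0)
    {T : ℝ} (hT0 : 0 ≤ T) (hTpi : T ≤ Real.pi) :
    g 0 * Real.cos (T / 2) ^ 2 + Real.sin (T / 2) ^ 2 / g 0 ≤ g T := by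
  set s : ℝ → ℝ := fun t => Real.sin ((T - t) / 2) with hs
  set c : ℝ → ℝ := fun t => Real.cos ((T - t) / 2) with hc
  have hlin : ∀ t, HasDerivAt (fun t : ℝ => (T - t) / 2) (-1 / 2) t := fun t => by
    simpa using ((hasDerivAt_id t).const_sub T).div_const 2
  have hds : ∀ t, HasDerivAt s (-c t / 2) t := fun t => by
    convert (hlin t).sin using 1; simp only [hc]; ring
  have hdc : ∀ t, HasDerivAt c (s t / 2) t := fun t => by
    convert (hlin t).cos using 1; simp only [hs]; ring
  have hs0 : ∀ t ∈ Set.Icc 0 T, 0 ≤ s t := fun t ht =>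
    Real.sin_nonneg_of_nonneg_of_le_pi (by linarith [ht.2]) (by linarith [ht.1, Real.pi_pos])
  set Y : ℝ → ℝ := fun t => g t * c t + g₁ t * s t with hY
  have hdY : ∀ t, HasDerivAt Y (g₁ t * c t / 2 + g t * s t / 2 + g₂ t * s t) t := fun t => by
    refine (((hg t).mul (hdc t)).add ((hg₁ t).mul (hds t))).congr_deriv ?_
    ring
  have hYg : MonotoneOn (fun t => Y t / Real.sqrt (g t)) (Set.Icc 0 T) := by
    have hd : ∀ t, HasDerivAt (fun t => Y t / Real.sqrt (g t))
        (s t * (g t * g₂ t - g₁ t ^ 2 / 2 + g t ^ 2 / 2) / (g t * Real.sqrt (g t))) t := fun t => by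
      have hq := Real.sqrt_pos.2 (hpos t)
      refine ((hdY t).div ((hg t).sqrt (hpos t).ne') hq.ne').congr_deriv ?_
      have h2 := Real.sq_sqrt (hpos t).le
      simp only [hY]
      generalize Real.sqrt (g t) = q at *
      rw [← h2]
      field_simp
      ring
    refine monotoneOn_of_deriv_nonneg (convex_Icc _ _)
      (fun t _ => (hd t).continuousAt.continuousWithinAt)
      (fun t _ => (hd t).differentiableAt.differentiableWithinAt) fun t ht => ?_
    rw [(hd t).deriv]
    rw [interior_Icc] at ht
    have h1 := hs0 t (Set.Ioo_subset_Icc_self ht)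
    have h2 := hineq t
    have h3 := hpos t
    exact div_nonneg (mul_nonneg h1 (by linarith)) (by positivity)
  have hY0 : ∀ t ∈ Set.Icc 0 T, 0 ≤ Y t := fun t ht => by
    have h1 := hYg (Set.left_mem_Icc.2 hT0) ht ht.1
    have h2 : 0 ≤ Y 0 := by
      simp only [hY, h0, zero_mul, add_zero]
      exact mul_nonneg (hpos 0).le
        (Real.cos_nonneg_of_neg_pi_div_two_le_of_le (by simp; linarith [Real.pi_pos])
          (by simp; linarith))
    have h3 := h1.trans' (div_nonneg h2 (Real.sqrt_nonneg _))
    have h4 := mul_nonneg h3 (Real.sqrt_nonneg (g t))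
    simpa [(Real.sqrt_pos.2 (hpos t)).ne'] using h4
  have hP : MonotoneOn (fun t => (Y t ^ 2 + s t ^ 2) / g t) (Set.Icc 0 T) := by
    have hd : ∀ t, HasDerivAt (fun t => (Y t ^ 2 + s t ^ 2) / g t)
        (2 * Y t * s t * (g t * g₂ t - g₁ t ^ 2 / 2 + g t ^ 2 / 2 - 1 / 2) / g t ^ 2) t :=
      fun t => by
      refine ((((hdY t).pow 2).add ((hds t).pow 2)).div (hg t) (hpos t).ne').congr_deriv ?_
      simp only [hY, Pi.add_apply, Pi.pow_apply]
      congr 1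
      push_cast
      ring
    refine monotoneOn_of_deriv_nonneg (convex_Icc _ _)
      (fun t _ => (hd t).continuousAt.continuousWithinAt)
      (fun t _ => (hd t).differentiableAt.differentiableWithinAt) fun t ht => ?_
    rw [(hd t).deriv]
    rw [interior_Icc] at ht
    have ht' := Set.Ioo_subset_Icc_self ht
    have h1 := hs0 t ht'
    have h2 := hineq t
    have h4 := hY0 t ht'
    exact div_nonneg (mul_nonneg (by positivity) (by linarith)) (by positivity)
  have := hP (Set.left_mem_Icc.2 hT0) (Set.right_mem_Icc.2 hT0) hT0
  have hne := (hpos 0).ne'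
  have hne' := (hpos T).ne'
  simp only [hY, hs, hc, h0, sub_zero, sub_self, zero_div, Real.sin_zero, Real.cos_zero] at this
  calc _ = _ := ?_
    _ ≤ _ := this
    _ = _ := ?_
  · field_simp
    ring
  · field_simp
    ring

/-- Second derivative test at a minimum, as a necessary condition. -/
theorem second_deriv_nonneg_of_isMin {g g₁ : ℝ → ℝ} {b : ℝ} (hg : ∀ t, HasDerivAt g (g₁ t) t)
    (hg₁ : HasDerivAt g₁ b 0) (hmin : ∀ t, g 0 ≤ g t) : 0 ≤ b := by
  by_contra! hb
  have h1 : deriv (fun t => -g t) = fun t => -g₁ t := funext fun t => (hg t).neg.deriv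
  have hg0 : g₁ 0 = 0 :=
    IsLocalMin.hasDerivAt_eq_zero (Filter.Eventually.of_forall hmin) (hg 0)
  have h2 : IsLocalMin (fun t => -g t) 0 := by
    refine isLocalMin_of_deriv_deriv_pos ?_ ?_ (hg 0).neg.continuousAt
    · rw [h1, show deriv (fun t => -g₁ t) 0 = -b from hg₁.neg.deriv]; linarith
    · rw [h1]; simp [hg0]
  have h3 : g =ᶠ[nhds 0] fun _ => g 0 := by
    filter_upwards [h2] with t ht
    exact le_antisymm (by linarith) (hmin t)
  have h4 : g₁ =ᶠ[nhds 0] fun _ => 0 := by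
    filter_upwards [h3.eventuallyEq_nhds] with t ht
    exact (hg t).unique ((hasDerivAt_const t (g 0)).congr_of_eventuallyEq ht)
  have h5 := hg₁.unique ((hasDerivAt_const (0 : ℝ) (0 : ℝ)).congr_of_eventuallyEq h4)
  linarith

section Sphere

variable {n : ℕ} {φ : Euc n → ℝ}

theorem norm_of_mem_uSphere {x : Euc n} (hx : x ∈ uSphere n) : ‖x‖ = 1 :=
  mem_sphere_zero_iff_norm.1 hx

theorem ne_zero_of_mem_uSphere {x : Euc n} (hx : x ∈ uSphere n) : x ≠ 0 := by
  rintro rfl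
  simpa using norm_of_mem_uSphere hx

theorem tanProj_of_inner_eq_zero {x v : Euc n} (h : ⟪x, v⟫ = 0) : tanProj x v = v := by
  simp [tanProj, h]

theorem SmoothFn.contDiffAt (hφ : SmoothFn φ) {y : Euc n} (hy : y ≠ 0) :
    ContDiffAt ℝ (⊤ : ℕ∞) φ y :=
  ContDiffOn.contDiffAt hφ (isOpen_ne.mem_nhds hy)

theorem SmoothFn.hasFDerivAt (hφ : SmoothFn φ) {y : Euc n} (hy : y ≠ 0) :
    HasFDerivAt φ (fderiv ℝ φ y) y :=
  ((hφ.contDiffAt hy).differentiableAt (by simp)).hasFDerivAt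

theorem SmoothFn.hasFDerivAt_fderiv (hφ : SmoothFn φ) {y : Euc n} (hy : y ≠ 0) :
    HasFDerivAt (fderiv ℝ φ) (fderiv ℝ (fderiv ℝ φ) y) y :=
  (((hφ.contDiffAt hy).fderiv_right (m := 1) (by norm_cast)).differentiableAt
    (by simp)).hasFDerivAt

theorem SmoothFn.fderiv_fderiv_comm (hφ : SmoothFn φ) {y : Euc n} (hy : y ≠ 0) (v w : Euc n) :
    fderiv ℝ (fderiv ℝ φ) y v w = fderiv ℝ (fderiv ℝ φ) y w v :=
  ((hφ.contDiffAt hy).isSymmSndFDerivAt (by simp; norm_cast)).eq v w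

theorem Homog0.fderiv_apply_self (h0 : Homog0 φ) (hφ : SmoothFn φ) {y : Euc n} (hy : y ≠ 0) :
    fderiv ℝ φ y y = 0 := by
  have h1 : HasDerivAt (fun c : ℝ => c • y) y 1 := by
    simpa using (hasDerivAt_id (1 : ℝ)).smul_const y
  have h2 : HasDerivAt (fun c : ℝ => φ (c • y)) (fderiv ℝ φ y y) 1 :=
    HasFDerivAt.comp_hasDerivAt (1 : ℝ) (by simpa using hφ.hasFDerivAt hy) h1
  have h3 : (fun c : ℝ => φ (c • y)) =ᶠ[nhds 1] fun _ => φ y := by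
    filter_upwards [lt_mem_nhds (zero_lt_one (α := ℝ))] with c hc using h0 c y hc
  exact h2.unique ((hasDerivAt_const (1 : ℝ) (φ y)).congr_of_eventuallyEq h3)

theorem covD_eq_fderiv (h0 : Homog0 φ) (hφ : SmoothFn φ) {y : Euc n} (hy : y ≠ 0)
    (w : Euc n) : covD φ y w = fderiv ℝ φ y w := by
  simp [covD, tanProj, h0.fderiv_apply_self hφ hy]

theorem hessS_eq_fderiv_fderiv (h0 : Homog0 φ) (hφ : SmoothFn φ) {x : Euc n} (hx : x ≠ 0)
    {v : Euc n} (hv : ⟪x, v⟫ = 0) (w : Euc n) :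
    hessS φ x v w = fderiv ℝ (fderiv ℝ φ) x v w := by
  have h1 : (fun y => covD φ y w) =ᶠ[nhds x] fun y => fderiv ℝ φ y w := by
    filter_upwards [isOpen_ne.mem_nhds hx] with y hy using covD_eq_fderiv h0 hφ hy w
  rw [hessS, h1.fderiv_eq, tanProj_of_inner_eq_zero hv,
    ((hφ.hasFDerivAt_fderiv hx).clm_apply (hasFDerivAt_const w x)).fderiv]
  simp

theorem Aform_eq (h0 : Homog0 φ) (hφ : SmoothFn φ) {x : Euc n} (hx : x ≠ 0)
    {v w : Euc n} (hv : ⟪x, v⟫ = 0) (hw : ⟪x, w⟫ = 0) :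
    Aform φ x v w = fderiv ℝ (fderiv ℝ φ) x v w +
      ((φ x - (φ x)⁻¹) / 2 - ‖gradS φ x‖ ^ 2 / (2 * φ x)) * ⟪v, w⟫ := by
  rw [Aform, hessS_eq_fderiv_fderiv h0 hφ hx hv, tanProj_of_inner_eq_zero hv,
    tanProj_of_inner_eq_zero hw]

theorem gradS_eq_gradient (h0 : Homog0 φ) (hφ : SmoothFn φ) {x : Euc n} (hx : x ≠ 0) :
    gradS φ x = gradient φ x := by
  refine tanProj_of_inner_eq_zero ?_
  rw [real_inner_comm, inner_gradient_left, h0.fderiv_apply_self hφ hx]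

/-- The great circle through `e` in direction `v`. -/
def greatCircle (e v : Euc n) (t : ℝ) : Euc n := Real.cos t • e + Real.sin t • v

@[simp] theorem greatCircle_zero (e v : Euc n) : greatCircle e v 0 = e := by
  simp [greatCircle]

theorem hasDerivAt_greatCircle (e v : Euc n) (t : ℝ) :
    HasDerivAt (greatCircle e v) (greatCircle v (-e) t) t := by
  refine (((Real.hasDerivAt_cos t).smul_const e).add
    ((Real.hasDerivAt_sin t).smul_const v)).congr_deriv ?_
  simp [greatCircle, add_comm]

theorem norm_greatCircle {e v : Euc n} (he : ‖e‖ = 1) (hv : ‖v‖ = 1) (hev : ⟪e, v⟫ = 0) (t : ℝ) :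
    ‖greatCircle e v t‖ = 1 := by
  have h : ‖greatCircle e v t‖ ^ 2 = 1 := by
    rw [greatCircle, norm_add_sq_real, norm_smul, norm_smul, he, hv, inner_smul_left,
      inner_smul_right, hev]
    simp
  nlinarith [norm_nonneg (greatCircle e v t)]

theorem inner_greatCircle {e v : Euc n} (he : ‖e‖ = 1) (hv : ‖v‖ = 1) (hev : ⟪e, v⟫ = 0)
    (t : ℝ) : ⟪greatCircle e v t, greatCircle v (-e) t⟫ = 0 := by
  have hve : ⟪v, e⟫ = 0 := by rw [real_inner_comm, hev]
  simp only [greatCircle, inner_add_left, inner_add_right, inner_smul_left, inner_smul_right,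
    inner_neg_right, hev, hve, real_inner_self_eq_norm_sq, he, hv, conj_trivial]
  ring

theorem greatCircle_mem {e v : Euc n} (he : ‖e‖ = 1) (hv : ‖v‖ = 1) (hev : ⟪e, v⟫ = 0) (t : ℝ) :
    greatCircle e v t ∈ uSphere n :=
  mem_sphere_zero_iff_norm.2 (norm_greatCircle he hv hev t)

theorem SmoothFn.hasDerivAt_greatCircle (hφ : SmoothFn φ) {e v : Euc n} (he : ‖e‖ = 1)
    (hv : ‖v‖ = 1) (hev : ⟪e, v⟫ = 0) (t : ℝ) :
    HasDerivAt (fun t => φ (greatCircle e v t))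
      (fderiv ℝ φ (greatCircle e v t) (greatCircle v (-e) t)) t :=
  (hφ.hasFDerivAt (ne_zero_of_mem_uSphere (greatCircle_mem he hv hev t))).comp_hasDerivAt t
    (_root_.hasDerivAt_greatCircle e v t)

theorem SmoothFn.hasDerivAt_fderiv_greatCircle (h0 : Homog0 φ) (hφ : SmoothFn φ) {e v : Euc n}
    (he : ‖e‖ = 1) (hv : ‖v‖ = 1) (hev : ⟪e, v⟫ = 0) (t : ℝ) :
    HasDerivAt (fun t => fderiv ℝ φ (greatCircle e v t) (greatCircle v (-e) t))
      (fderiv ℝ (fderiv ℝ φ) (greatCircle e v t) (greatCircle v (-e) t)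
        (greatCircle v (-e) t)) t := by
  have hne := ne_zero_of_mem_uSphere (greatCircle_mem he hv hev t)
  have h1 := (hφ.hasFDerivAt_fderiv hne).comp_hasDerivAt t (_root_.hasDerivAt_greatCircle e v t)
  have h2 : greatCircle (-e) (-v) t = -greatCircle e v t := by
    simp [greatCircle, add_comm]
  refine (h1.clm_apply (_root_.hasDerivAt_greatCircle v (-e) t)).congr_deriv ?_
  simp [h2, h0.fderiv_apply_self hφ hne]

theorem fderiv_eq_zero_of_isExtrOn (h0 : Homog0 φ) {x : Euc n}
    (hx : x ∈ uSphere n) (h : IsExtrOn φ (uSphere n) x) : fderiv ℝ φ x = 0 := by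
  have hx0 := ne_zero_of_mem_uSphere hx
  refine IsLocalExtr.fderiv_eq_zero ?_
  have key : ∀ y : Euc n, y ≠ 0 → ∃ z ∈ uSphere n, φ y = φ z := fun y hy =>
    ⟨‖y‖⁻¹ • y, mem_sphere_zero_iff_norm.2 (by simp [norm_smul, hy]),
      (h0 _ y (inv_pos.2 (norm_pos_iff.2 hy))).symm⟩
  refine h.imp (fun h => ?_) fun h => ?_ <;>
  · filter_upwards [isOpen_ne.mem_nhds hx0] with y hy
    obtain ⟨z, hz, hyz⟩ := key y hy
    rw [hyz]
    exact h hz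

theorem fderiv_fderiv_nonneg_of_isMinOn (h0 : Homog0 φ) (hφ : SmoothFn φ) {x : Euc n}
    (hx : x ∈ uSphere n) (h : IsMinOn φ (uSphere n) x) {v : Euc n} (hxv : ⟪x, v⟫ = 0) :
    0 ≤ fderiv ℝ (fderiv ℝ φ) x v v := by
  rcases eq_or_ne v 0 with rfl | hv
  · simp
  have hx1 := norm_of_mem_uSphere hx
  set w : Euc n := ‖v‖⁻¹ • v with hw
  have hw1 : ‖w‖ = 1 := by simp [hw, norm_smul, hv]
  have hxw : ⟪x, w⟫ = 0 := by simp [hw, inner_smul_right, hxv]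
  have h1 := second_deriv_nonneg_of_isMin (hφ.hasDerivAt_greatCircle hx1 hw1 hxw)
    (hφ.hasDerivAt_fderiv_greatCircle h0 hx1 hw1 hxw 0)
    (fun t => by simpa using h (greatCircle_mem hx1 hw1 hxw t))
  have hvw : v = ‖v‖ • w := by simp [hw, smul_smul, hv]
  simp only [greatCircle_zero] at h1
  rw [hvw]
  simp only [map_smul, _root_.smul_apply, smul_eq_mul]
  positivity

theorem fderiv_fderiv_nonpos_of_isMaxOn (h0 : Homog0 φ) (hφ : SmoothFn φ) {x : Euc n}
    (hx : x ∈ uSphere n) (h : IsMaxOn φ (uSphere n) x) {v : Euc n} (hxv : ⟪x, v⟫ = 0) :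
    fderiv ℝ (fderiv ℝ φ) x v v ≤ 0 := by
  have h0' : Homog0 (-φ) := fun c y hc => congrArg Neg.neg (h0 c y hc)
  have hφ' : SmoothFn (-φ) := ContDiffOn.neg hφ
  have h1 := fderiv_fderiv_nonneg_of_isMinOn h0' hφ' hx h.neg hxv
  have h2 : fderiv ℝ (-φ) = -fderiv ℝ φ := funext fun y => fderiv_neg
  rw [h2, fderiv_neg] at h1
  simpa using h1

/-- An even h-convex function is bounded below in terms of its maximum. -/
theorem HConvex.half_add_inv_le (h0 : Homog0 φ) (hφ : SmoothFn φ) (heven : EvenFn φ)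
    (hpos : ∀ x ∈ uSphere n, 1 < φ x) (hc : HConvex φ) {e x : Euc n} (he : e ∈ uSphere n)
    (hmax : IsMaxOn φ (uSphere n) e) (hx : x ∈ uSphere n) :
    (φ e + (φ e)⁻¹) / 2 ≤ φ x := by
  wlog hex : 0 ≤ ⟪e, x⟫ generalizing x
  · rw [← heven x]
    exact this (mem_sphere_zero_iff_norm.2 (by simpa using norm_of_mem_uSphere hx))
      (by rw [inner_neg_right]; linarith)
  have he1 := norm_of_mem_uSphere he
  have hx1 := norm_of_mem_uSphere hx
  have hM := hpos e he
  have hM0 : 0 < φ e := by linarith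
  have hMinv : (φ e)⁻¹ ≤ 1 := inv_le_one_of_one_le₀ hM.le
  set a := ⟪e, x⟫ with ha
  rcases eq_or_ne (x - a • e) 0 with hz | hz
  · have hxe : x = a • e := sub_eq_zero.1 hz
    have ha1 : 0 < a := by
      refine lt_of_le_of_ne hex fun h => ?_
      rw [hxe, ← h, zero_smul] at hx1
      simp at hx1
    rw [hxe, h0 a e ha1]
    linarith
  set w := x - a • e with hw
  set v : Euc n := ‖w‖⁻¹ • w with hv
  have hv1 : ‖v‖ = 1 := by simp [hv, norm_smul, hz]
  have hew : ⟪e, w⟫ = 0 := by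
    simp [hw, inner_sub_right, inner_smul_right, ← ha, he1]
  have hev : ⟪e, v⟫ = 0 := by simp [hv, inner_smul_right, hew]
  have hwv : w = ‖w‖ • v := by simp [hv, smul_smul, hz]
  have hxew : x = a • e + ‖w‖ • v := by rw [← hwv, hw]; simp
  have hsq : a ^ 2 + ‖w‖ ^ 2 = 1 := by
    have h1 : ‖x‖ ^ 2 = a ^ 2 + ‖w‖ ^ 2 := by
      conv_lhs => rw [hxew]
      rw [norm_add_sq_real, norm_smul, norm_smul, he1, hv1, inner_smul_left, inner_smul_right, hev]
      simp
    rw [← h1, hx1, one_pow]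
  have ha1 : a ≤ 1 := by nlinarith [norm_nonneg w]
  set T := Real.arccos a with hT
  have hcos : Real.cos T = a := Real.cos_arccos (by linarith) ha1
  have hsin : Real.sin T = ‖w‖ := by
    rw [hT, Real.sin_arccos, ← hsq]
    simp
  have hxT : x = greatCircle e v T := by rw [greatCircle, hcos, hsin, ← hxew]
  have hmem := greatCircle_mem he1 hv1 hev
  have hcomp := horospherical_comparison (hφ.hasDerivAt_greatCircle he1 hv1 hev)
    (hφ.hasDerivAt_fderiv_greatCircle h0 he1 hv1 hev)
    (fun t => zero_lt_one.trans (hpos _ (hmem t))) (fun t => ?_)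
    (by simp [fderiv_eq_zero_of_isExtrOn h0 he (Or.inr hmax)])
    (Real.arccos_nonneg a) (Real.arccos_le_pi a)
  · rw [greatCircle_zero, ← hT, ← hxT, Real.cos_sq, Real.sin_sq_eq_half_sub,
      show 2 * (T / 2) = T by ring, hcos] at hcomp
    refine le_trans ?_ hcomp
    rw [div_eq_mul_inv _ (φ e)]
    nlinarith [mul_nonneg hex (sub_nonneg.2 (hMinv.trans hM.le))]
  · set y := greatCircle e v t with hy
    set u := greatCircle v (-e) t with hu
    have hy0 := ne_zero_of_mem_uSphere (hmem t)
    have hu1 : ‖u‖ = 1 := norm_greatCircle hv1 (by simpa using he1)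
      (by rw [inner_neg_right, real_inner_comm, hev, neg_zero]) t
    have hyu : ⟪y, u⟫ = 0 := inner_greatCircle he1 hv1 hev t
    have h1 := hc y (hmem t) u hyu
    rw [Aform_eq h0 hφ hy0 hyu hyu, real_inner_self_eq_norm_sq, hu1, gradS_eq_gradient h0 hφ hy0]
      at h1
    have h2 : (fderiv ℝ φ y u) ^ 2 ≤ ‖gradient φ y‖ ^ 2 := by
      rw [← inner_gradient_left, ← sq_abs]
      gcongr
      simpa [hu1] using abs_real_inner_le_norm (gradient φ y) u
    have h3 : 0 < φ y := zero_lt_one.trans (hpos y (hmem t))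
    have h4 := mul_nonneg h3.le h1
    have h5 : φ y * (fderiv ℝ (fderiv ℝ φ) y u u +
        ((φ y - (φ y)⁻¹) / 2 - ‖gradient φ y‖ ^ 2 / (2 * φ y)) * 1 ^ 2) =
        φ y * fderiv ℝ (fderiv ℝ φ) y u u + φ y ^ 2 / 2 - 1 / 2 - ‖gradient φ y‖ ^ 2 / 2 := by
      field_simp
      ring
    rw [h5] at h4
    linarith

theorem exists_orthoFrame {x : Euc n} (hx : x ∈ uSphere n) :
    ∃ e : Fin n → Euc n, OrthoFrame x e := by
  have : Fact (Module.finrank ℝ (Euc n) = n + 1) := ⟨by simp⟩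
  set b := OrthonormalBasis.fromOrthogonalSpanSingleton (𝕜 := ℝ) n (ne_zero_of_mem_uSphere hx)
  refine ⟨fun i => b i, fun i => ?_, fun i j => ?_⟩
  · exact Submodule.mem_orthogonal_singleton_iff_inner_right.1 (b i).2
  · exact orthonormal_iff_ite.1 b.orthonormal i j

section Frame

variable {x : Euc n} {e : Fin n → Euc n}

theorem OrthoFrame.inner_sum_eq_zero (he : OrthoFrame x e) (c : Fin n → ℝ) :
    ⟪x, ∑ i, c i • e i⟫ = 0 := by
  simp [inner_sum, inner_smul_right, he.1]

theorem OrthoFrame.dotProduct_Amat_mulVec (h0 : Homog0 φ) (hφ : SmoothFn φ) (hx : x ∈ uSphere n)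
    (he : OrthoFrame x e) (c : Fin n → ℝ) :
    c ⬝ᵥ (Amat φ x e).mulVec c = Aform φ x (∑ i, c i • e i) (∑ i, c i • e i) := by
  have hx0 := ne_zero_of_mem_uSphere hx
  rw [Aform_eq h0 hφ hx0 (he.inner_sum_eq_zero c) (he.inner_sum_eq_zero c)]
  simp only [dotProduct, Matrix.mulVec, Amat, Matrix.of_apply,
    Aform_eq h0 hφ hx0 (he.1 _) (he.1 _), sum_inner, inner_sum, map_sum, map_smul,
    _root_.sum_apply, _root_.smul_apply, inner_smul_left, inner_smul_right,
    smul_eq_mul, Finset.mul_sum, conj_trivial, add_mul, mul_add, Finset.sum_add_distrib]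
  congr 1
  · rw [Finset.sum_comm]
    exact Finset.sum_congr rfl fun i _ => Finset.sum_congr rfl fun j _ => by
      rw [hφ.fderiv_fderiv_comm hx0 (e j) (e i)]; ring
  · exact Finset.sum_congr rfl fun i _ => Finset.sum_congr rfl fun j _ => by
      rw [real_inner_comm (e i) (e j)]; ring

theorem OrthoFrame.dotProduct_self (he : OrthoFrame x e) (c : Fin n → ℝ) :
    c ⬝ᵥ c = ⟪∑ i, c i • e i, ∑ i, c i • e i⟫ := by
  simp only [dotProduct, sum_inner, inner_sum, inner_smul_left, inner_smul_right, he.2]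
  simp

theorem OrthoFrame.isHermitian_Amat (h0 : Homog0 φ) (hφ : SmoothFn φ) (hx : x ∈ uSphere n)
    (he : OrthoFrame x e) : (Amat φ x e).IsHermitian := by
  have hx0 := ne_zero_of_mem_uSphere hx
  ext i j
  simp [Amat, Aform_eq h0 hφ hx0 (he.1 _) (he.1 _), hφ.fderiv_fderiv_comm hx0 (e j) (e i),
    real_inner_comm]

end Frame

theorem isHermitian_smul_one {N : ℕ} (a : ℝ) :
    (a • (1 : Matrix (Fin N) (Fin N) ℝ)).IsHermitian := by
  ext i j
  simp [Matrix.one_apply, eq_comm]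

variable {k : ℕ} {f : Euc n → ℝ}

theorem SolvesCM.sigmaMat_mul (hsol : SolvesCM n k 0 f φ) {x : Euc n} (hx : x ∈ uSphere n)
    (hpos : 0 < φ x) {e : Fin n → Euc n} (he : OrthoFrame x e) :
    f x = φ x ^ k * sigmaMat k (Amat φ x e) := by
  rw [hsol x hx e he, zero_sub, Real.rpow_neg hpos.le, Real.rpow_natCast]
  field_simp

theorem rpow_one_div_le_iff_le_choose_mul (hk1 : 1 ≤ k) (hkn : k ≤ n) {a b : ℝ} (ha : 0 ≤ a)
    (hb : 0 ≤ b) : (a / (n.choose k : ℝ)) ^ (1 / (k : ℝ)) ≤ b ↔ a ≤ (n.choose k : ℝ) * b ^ k := by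
  have hC : (0 : ℝ) < n.choose k := by exact_mod_cast Nat.choose_pos hkn
  have hk : (0 : ℝ) < k := by exact_mod_cast hk1
  rw [one_div, Real.rpow_inv_le_iff_of_pos (by positivity) hb hk, Real.rpow_natCast,
    div_le_iff₀' hC]

theorem le_rpow_one_div_iff_choose_mul_le (hk1 : 1 ≤ k) (hkn : k ≤ n) {a b : ℝ} (ha : 0 ≤ a)
    (hb : 0 ≤ b) : b ≤ (a / (n.choose k : ℝ)) ^ (1 / (k : ℝ)) ↔ (n.choose k : ℝ) * b ^ k ≤ a := by
  have hC : (0 : ℝ) < n.choose k := by exact_mod_cast Nat.choose_pos hkn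
  have hk : (0 : ℝ) < k := by exact_mod_cast hk1
  rw [one_div, Real.le_rpow_inv_iff_of_pos hb (by positivity) hk, Real.rpow_natCast,
    le_div_iff₀' hC]

theorem Aform_of_isExtrOn (h0 : Homog0 φ) (hφ : SmoothFn φ) {x : Euc n} (hx : x ∈ uSphere n)
    (h : IsExtrOn φ (uSphere n) x) {v : Euc n} (hv : ⟪x, v⟫ = 0) :
    Aform φ x v v = fderiv ℝ (fderiv ℝ φ) x v v + (φ x - (φ x)⁻¹) / 2 * ⟪v, v⟫ := by
  have hx0 := ne_zero_of_mem_uSphere hx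
  rw [Aform_eq h0 hφ hx0 hv hv, gradS_eq_gradient h0 hφ hx0, gradient,
    fderiv_eq_zero_of_isExtrOn h0 hx h]
  simp

/-- At a maximum point of `φ`, the equation bounds `φ` from below. -/
theorem SolvesCM.le_of_isMaxOn (hk1 : 1 ≤ k) (hkn : k ≤ n) (h0 : Homog0 φ) (hφ : SmoothFn φ)
    (hpos : ∀ x ∈ uSphere n, 1 < φ x) (hc : HConvex φ) (hsol : SolvesCM n k 0 f φ)
    (hfpos : ∀ x ∈ uSphere n, 0 < f x) {x : Euc n} (hx : x ∈ uSphere n)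
    (h : IsMaxOn φ (uSphere n) x) :
    (f x / (n.choose k : ℝ)) ^ (1 / (k : ℝ)) ≤ (φ x ^ 2 - 1) / 2 := by
  obtain ⟨e, he⟩ := exists_orthoFrame hx
  have h1 := hpos x hx
  have hp : 0 < φ x := by linarith
  rw [rpow_one_div_le_iff_le_choose_mul hk1 hkn (hfpos x hx).le (by nlinarith),
    hsol.sigmaMat_mul hx hp he,
    show (φ x ^ 2 - 1) / 2 = φ x * ((φ x - (φ x)⁻¹) / 2) by field_simp, mul_pow, mul_left_comm]
  refine mul_le_mul_of_nonneg_left (sigmaMat_le ?_ ?_) (by positivity)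
  · refine Matrix.PosSemidef.of_dotProduct_mulVec_nonneg (he.isHermitian_Amat h0 hφ hx) fun c => ?_
    rw [star_trivial, he.dotProduct_Amat_mulVec h0 hφ hx]
    exact hc x hx _ (he.inner_sum_eq_zero c)
  · refine Matrix.PosSemidef.of_dotProduct_mulVec_nonneg
      ((isHermitian_smul_one _).sub (he.isHermitian_Amat h0 hφ hx)) fun c => ?_
    have hs := he.inner_sum_eq_zero c
    rw [star_trivial, Matrix.sub_mulVec, dotProduct_sub, he.dotProduct_Amat_mulVec h0 hφ hx,
      Matrix.smul_mulVec, Matrix.one_mulVec, dotProduct_smul, he.dotProduct_self,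
      Aform_of_isExtrOn h0 hφ hx (Or.inr h) hs, smul_eq_mul]
    linarith [fderiv_fderiv_nonpos_of_isMaxOn h0 hφ hx h hs]

/-- At a minimum point of `φ`, the equation bounds `φ` from above. -/
theorem SolvesCM.ge_of_isMinOn (hk1 : 1 ≤ k) (hkn : k ≤ n) (h0 : Homog0 φ) (hφ : SmoothFn φ)
    (hpos : ∀ x ∈ uSphere n, 1 < φ x) (hsol : SolvesCM n k 0 f φ)
    (hfpos : ∀ x ∈ uSphere n, 0 < f x) {x : Euc n} (hx : x ∈ uSphere n)
    (h : IsMinOn φ (uSphere n) x) :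
    (φ x ^ 2 - 1) / 2 ≤ (f x / (n.choose k : ℝ)) ^ (1 / (k : ℝ)) := by
  obtain ⟨e, he⟩ := exists_orthoFrame hx
  have h1 := hpos x hx
  have hp : 0 < φ x := by linarith
  have hinv : (φ x)⁻¹ ≤ 1 := inv_le_one_of_one_le₀ h1.le
  rw [le_rpow_one_div_iff_choose_mul_le hk1 hkn (hfpos x hx).le (by nlinarith),
    hsol.sigmaMat_mul hx hp he,
    show (φ x ^ 2 - 1) / 2 = φ x * ((φ x - (φ x)⁻¹) / 2) by field_simp, mul_pow, mul_left_comm]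
  refine mul_le_mul_of_nonneg_left (le_sigmaMat (by linarith) ?_) (by positivity)
  refine Matrix.PosSemidef.of_dotProduct_mulVec_nonneg
    ((he.isHermitian_Amat h0 hφ hx).sub (isHermitian_smul_one _)) fun c => ?_
  have hs := he.inner_sum_eq_zero c
  rw [star_trivial, Matrix.sub_mulVec, dotProduct_sub, he.dotProduct_Amat_mulVec h0 hφ hx,
    Matrix.smul_mulVec, Matrix.one_mulVec, dotProduct_smul, he.dotProduct_self,
    Aform_of_isExtrOn h0 hφ hx (Or.inl h) hs, smul_eq_mul]
  linarith [fderiv_fderiv_nonneg_of_isMinOn h0 hφ hx h hs]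

theorem isCompact_uSphere : IsCompact (uSphere n) := isCompact_sphere 0 1

theorem uSphere_nonempty : (uSphere n).Nonempty :=
  NormedSpace.sphere_nonempty.2 zero_le_one

theorem SmoothFn.continuousOn (hφ : SmoothFn φ) : ContinuousOn φ (uSphere n) :=
  (ContDiffOn.continuousOn hφ).mono fun _ => ne_zero_of_mem_uSphere

end Sphere

/-- **C⁰ estimate, case `p = 0`** (Lemma 3.1(1) of Luo–Wei): for any smooth, even, h-convex
solution `φ > 1` of `σ_k(A[φ]) = φ^{-k} f` on `𝕊ⁿ` one has
`min φ ≥ C₀ := ½(1 + 2 min(f/C(n,k))^{1/k})^{1/2} + ½(1 + 2 min(f/C(n,k))^{1/k})^{-1/2} > 1`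
and `max φ ≤ (1 + 2 max(f/C(n,k))^{1/k})^{1/2} + (2 max(f/C(n,k))^{1/k})^{1/2}`. -/
theorem c0_estimate_p_zero (n k : ℕ) (hn : 2 ≤ n) (hk1 : 1 ≤ k) (hk2 : k ≤ n - 1)
    (f φ : Euc n → ℝ)
    (hf0 : Homog0 f) (hfs : SmoothFn f) (hfe : EvenFn f)
    (hfpos : ∀ x ∈ uSphere n, 0 < f x)
    (hφ0 : Homog0 φ) (hφs : SmoothFn φ) (hφe : EvenFn φ)
    (hφ1 : ∀ x ∈ uSphere n, 1 < φ x) (hφc : HConvex φ)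
    (hsol : SolvesCM n k 0 f φ) :
    (1 < Real.sqrt (1 + 2 * sphInf fun y => (f y / (n.choose k : ℝ)) ^ (1 / (k : ℝ))) / 2 +
          1 / (2 * Real.sqrt (1 + 2 * sphInf fun y => (f y / (n.choose k : ℝ)) ^ (1 / (k : ℝ))))) ∧
    (Real.sqrt (1 + 2 * sphInf fun y => (f y / (n.choose k : ℝ)) ^ (1 / (k : ℝ))) / 2 +
        1 / (2 * Real.sqrt (1 + 2 * sphInf fun y => (f y / (n.choose k : ℝ)) ^ (1 / (k : ℝ)))) ≤
      sphInf φ) ∧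
    sphSup φ ≤ Real.sqrt (1 + 2 * sphSup fun y => (f y / (n.choose k : ℝ)) ^ (1 / (k : ℝ))) +
        Real.sqrt (2 * sphSup fun y => (f y / (n.choose k : ℝ)) ^ (1 / (k : ℝ))) := by
  have hkn : k ≤ n := by omega
  have hC : (0 : ℝ) < n.choose k := by exact_mod_cast Nat.choose_pos hkn
  obtain ⟨e, he, hmax⟩ := isCompact_uSphere.exists_isMaxOn uSphere_nonempty hφs.continuousOn
  obtain ⟨z, hz, hmin⟩ := isCompact_uSphere.exists_isMinOn uSphere_nonempty hφs.continuousOn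
  set F : Euc n → ℝ := fun y => (f y / (n.choose k : ℝ)) ^ (1 / (k : ℝ)) with hF
  have hFc : ContinuousOn F (uSphere n) :=
    (hfs.continuousOn.div_const _).rpow_const fun x hx => Or.inl (div_pos (hfpos x hx) hC).ne'
  have hFimg := isCompact_uSphere.image_of_continuousOn hFc
  have hF0 : 0 < sphInf F := by
    obtain ⟨y, hy, hyF⟩ := hFimg.sInf_mem (uSphere_nonempty.image F)
    rw [sphInf, ← hyF]
    exact Real.rpow_pos_of_pos (div_pos (hfpos y hy) hC) _
  have hinf : sphInf F ≤ F e := csInf_le hFimg.bddBelow ⟨e, he, rfl⟩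
  have hsup : F z ≤ sphSup F := le_csSup hFimg.bddAbove ⟨z, hz, rfl⟩
  have hM : sphInf F ≤ (φ e ^ 2 - 1) / 2 :=
    hinf.trans (hsol.le_of_isMaxOn hk1 hkn hφ0 hφs hφ1 hφc hfpos he hmax)
  have hm : (φ z ^ 2 - 1) / 2 ≤ sphSup F :=
    (hsol.ge_of_isMinOn hk1 hkn hφ0 hφs hφ1 hfpos hz hmin).trans hsup
  have hcmp := hφc.half_add_inv_le hφ0 hφs hφe hφ1 he hmax hz
  have hφinf : sphInf φ = φ z :=
    IsLeast.csInf_eq ⟨⟨z, hz, rfl⟩, by rintro _ ⟨y, hy, rfl⟩; exact hmin hy⟩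
  have hφsup : sphSup φ = φ e :=
    IsGreatest.csSup_eq ⟨⟨e, he, rfl⟩, by rintro _ ⟨y, hy, rfl⟩; exact hmax hy⟩
  have he1 := hφ1 e he
  have hz1 := hφ1 z hz
  rw [hφinf, hφsup]
  generalize φ e = M at *
  generalize φ z = m at *
  generalize sphInf F = μ at *
  generalize sphSup F = ν at *
  have hs1 : 1 < √(1 + 2 * μ) := Real.lt_sqrt_of_sq_lt (by linarith)
  have hsM : √(1 + 2 * μ) ≤ M := Real.sqrt_le_left (by linarith) |>.2 (by linarith)
  have hM0 : 0 < M := by linarith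
  refine ⟨?_, ?_, ?_⟩
  · generalize √(1 + 2 * μ) = s at *
    have : s / 2 + 1 / (2 * s) - 1 = (s - 1) ^ 2 / (2 * s) := by field_simp; ring
    have : 0 < (s - 1) ^ 2 / (2 * s) := div_pos (pow_pos (by linarith) 2) (by linarith)
    linarith
  · refine le_trans ?_ hcmp
    generalize √(1 + 2 * μ) = s at *
    have h1 : (M + M⁻¹) / 2 - (s / 2 + 1 / (2 * s)) = (M - s) * (M * s - 1) / (2 * M * s) := by
      field_simp
      ring
    have h2 : 0 ≤ (M - s) * (M * s - 1) / (2 * M * s) :=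
      div_nonneg (mul_nonneg (by linarith) (by nlinarith)) (by nlinarith)
    linarith
  · have h1 : M ^ 2 + 1 ≤ 2 * m * M := by
      have := mul_le_mul_of_nonneg_right hcmp hM0.le
      rw [div_mul_eq_mul_div, add_mul, inv_mul_cancel₀ hM0.ne'] at this
      linarith
    have h2 : m ≤ √(1 + 2 * ν) := Real.le_sqrt_of_sq_le (by linarith)
    have h3 : M - m ≤ √(2 * ν) := Real.le_sqrt_of_sq_le (by nlinarith)
    linarith
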